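/- arXiv:1502.00795 — 3 statements merged into one kernel-verified Lean document; each statement's English description precedes it below -/
import Mathlib

section
/- The two 4×4 matrices Ξ¹ and Ξ² of the Pfaffian system of Appell's F₄ (given explicitly in Theorem 4.5 of the paper, with entries rational in λ₁,...,λ₄, x₁, x₂) satisfy the integrability condition Ξ¹Ξ² − Ξ²Ξ¹ = −∂Ξ¹/∂x₂ + ∂Ξ²/∂x₁ as matrices of rational functions. -/
open Matrix

noncomputable def Rpoly (x₁ x₂ : ℂ) : ℂ :=
  x₁ ^ 2 + x₂ ^ 2 - 2 * x₁ * x₂ - 2 * x₁ - 2 * x₂ + 1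

/-- The matrix `Ξ¹` of Theorem 4.5. -/
noncomputable def Xi1 (l₁ l₂ l₃ l₄ x₁ x₂ : ℂ) : Matrix (Fin 4) (Fin 4) ℂ :=
  let R := Rpoly x₁ x₂
  !![0, -l₄ / x₁, 0, 0;
     0, -(l₁ + l₃) / x₁, 0, -l₃;
     -(l₁ + l₂ + l₃) / (2 * x₁), -(l₂ - l₄) / (2 * x₁), -(l₁ - l₄) / (2 * x₁),
       -(l₃ * (1 - x₁ - x₂)) / (2 * x₁);
     ((l₁ + l₂ + l₃) / l₃) * ((l₁ - l₂) / R - (l₁ + 2 * l₃ + l₄) * (1 + x₁ - x₂) / (2 * x₁ * R)),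
       -((l₂ - l₄) * (l₂ + 2 * l₃ + l₄)) / (l₃ * R)
         + (l₁ * l₂ + l₁ * l₄ + l₂ * l₄ + 2 * l₃ * l₄ + l₄ ^ 2) / (2 * l₃)
           * ((1 - x₁ - x₂) / (x₁ * R)),
       (l₁ * l₂ + l₁ * l₄ + l₂ * l₄ + 2 * l₃ * l₄ + l₄ ^ 2) / (l₃ * R)
         - ((l₁ - l₄) * (l₁ + l₄ + 2 * l₃)) / (2 * l₃) * ((1 - x₁ - x₂) / (x₁ * R)),
       -(l₁ - 2 * l₃ - 3 * l₄ + 2) * (x₁ / (2 * R))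
         + (l₁ - l₄ + 1) * ((1 + x₂) / R)
         - (l₁ + 2 * l₃ + l₄) * ((x₂ - 1) ^ 2 / (2 * x₁ * R))]

/-- The matrix `Ξ²` of Theorem 4.5. -/
noncomputable def Xi2 (l₁ l₂ l₃ l₄ x₁ x₂ : ℂ) : Matrix (Fin 4) (Fin 4) ℂ :=
  let R := Rpoly x₁ x₂
  !![0, 0, -l₄ / x₂, 0;
     -(l₁ + l₂ + l₃) / (2 * x₂), -(l₂ - l₄) / (2 * x₂), -(l₁ - l₄) / (2 * x₂),
       -(l₃ * (1 - x₁ - x₂)) / (2 * x₂);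
     0, 0, -(l₂ + l₃) / x₂, -l₃;
     ((l₁ + l₂ + l₃) / l₃) * ((l₂ - l₁) / R - (l₂ + 2 * l₃ + l₄) * (1 - x₁ + x₂) / (2 * x₂ * R)),
       (l₁ * l₂ + l₁ * l₄ + l₂ * l₄ + 2 * l₃ * l₄ + l₄ ^ 2) / (l₃ * R)
         - ((l₂ - l₄) * (l₂ + 2 * l₃ + l₄)) / (2 * l₃) * ((1 - x₁ - x₂) / (x₂ * R)),
       -((l₁ - l₄) * (l₁ + l₄ + 2 * l₃)) / (l₃ * R)
         + (l₁ * l₂ + l₁ * l₄ + l₂ * l₄ + 2 * l₃ * l₄ + l₄ ^ 2) / (2 * l₃)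
           * ((1 - x₁ - x₂) / (x₂ * R)),
       -(l₂ - 2 * l₃ - 3 * l₄ + 2) * (x₂ / (2 * R))
         + (l₂ - l₄ + 1) * ((x₁ + 1) / R)
         - (l₂ + 2 * l₃ + l₄) * ((x₁ - 1) ^ 2 / (2 * x₂ * R))]

lemma Rpoly_hasDerivAt_snd (x₁ x₂ : ℂ) :
    HasDerivAt (fun t => Rpoly x₁ t) (2 * x₂ - 2 * x₁ - 2) x₂ := by
  have h := (((((hasDerivAt_const x₂ (x₁ ^ 2)).add ((hasDerivAt_id x₂).pow 2)).sub
    ((hasDerivAt_id x₂).const_mul (2 * x₁))).sub (hasDerivAt_const x₂ (2 * x₁))).sub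
    ((hasDerivAt_id x₂).const_mul 2)).add (hasDerivAt_const x₂ 1)
  refine (h.congr_deriv ?_).congr_of_eventuallyEq (Filter.Eventually.of_forall fun t => ?_)
  · simp
  · simp [Rpoly]

lemma Rpoly_comm (x₁ x₂ : ℂ) : Rpoly x₁ x₂ = Rpoly x₂ x₁ := by
  unfold Rpoly
  ring

lemma quad_hasDerivAt (a b c x : ℂ) :
    HasDerivAt (fun t => a + b * t + c * t ^ 2) (b + 2 * c * x) x := by
  have h := ((hasDerivAt_const x a).add ((hasDerivAt_id x).const_mul b)).add
    (((hasDerivAt_id x).pow 2).const_mul c)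
  refine (h.congr_deriv ?_).congr_of_eventuallyEq (Filter.Eventually.of_forall fun t => ?_)
  · simp
    ring
  · simp

/-- Derivative of a quadratic in the second variable. -/
lemma deriv_quad {f : ℂ → ℂ} (a b c x : ℂ) (hf : ∀ t, f t = a + b * t + c * t ^ 2) :
    deriv f x = b + 2 * c * x := by
  rw [funext hf]
  exact (quad_hasDerivAt a b c x).deriv

/-- Derivative of a quadratic over `R` in the second variable. -/
lemma deriv_snd {f : ℂ → ℂ} (a b c x₁ x₂ : ℂ) (hR : Rpoly x₁ x₂ ≠ 0)
    (hf : ∀ t, f t = (a + b * t + c * t ^ 2) * (Rpoly x₁ t)⁻¹) :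
    deriv f x₂ = ((b + 2 * c * x₂) * Rpoly x₁ x₂
      - (a + b * x₂ + c * x₂ ^ 2) * (2 * x₂ - 2 * x₁ - 2)) / Rpoly x₁ x₂ ^ 2 := by
  have h : f = fun t => (a + b * t + c * t ^ 2) / Rpoly x₁ t := by
    funext t
    rw [hf, div_eq_mul_inv]
  rw [h]
  exact ((quad_hasDerivAt a b c x₂).div (Rpoly_hasDerivAt_snd x₁ x₂) hR).deriv

/-- Derivative of a quadratic over `R` in the first variable. -/
lemma deriv_fst {f : ℂ → ℂ} (a b c x₁ x₂ : ℂ) (hR : Rpoly x₁ x₂ ≠ 0)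
    (hf : ∀ t, f t = (a + b * t + c * t ^ 2) * (Rpoly t x₂)⁻¹) :
    deriv f x₁ = ((b + 2 * c * x₁) * Rpoly x₁ x₂
      - (a + b * x₁ + c * x₁ ^ 2) * (2 * x₁ - 2 * x₂ - 2)) / Rpoly x₁ x₂ ^ 2 := by
  rw [Rpoly_comm x₁ x₂] at hR ⊢
  exact deriv_snd a b c x₂ x₁ hR fun t => by rw [hf, Rpoly_comm]

set_option maxHeartbeats 4000000 in
/-- Integrability of the Pfaffian system of `F₄`:
`Ξ¹Ξ² - Ξ²Ξ¹ = -∂Ξ¹/∂x₂ + ∂Ξ²/∂x₁`, i.e. `Ξ¹Ξ² - Ξ²Ξ¹ + ∂_{x₂}Ξ¹ - ∂_{x₁}Ξ² = 0`. -/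
theorem Xi_integrability (l₁ l₂ l₃ l₄ x₁ x₂ : ℂ)
    (hx₁ : x₁ ≠ 0) (hx₂ : x₂ ≠ 0) (hl₃ : l₃ ≠ 0) (hR : Rpoly x₁ x₂ ≠ 0) :
    ∀ i j : Fin 4,
      (Xi1 l₁ l₂ l₃ l₄ x₁ x₂ * Xi2 l₁ l₂ l₃ l₄ x₁ x₂
        - Xi2 l₁ l₂ l₃ l₄ x₁ x₂ * Xi1 l₁ l₂ l₃ l₄ x₁ x₂) i j
      + deriv (fun t => Xi1 l₁ l₂ l₃ l₄ x₁ t i j) x₂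
      - deriv (fun t => Xi2 l₁ l₂ l₃ l₄ t x₂ i j) x₁ = 0 := by
  have d10 := deriv_snd (f := fun t => Xi1 l₁ l₂ l₃ l₄ x₁ t 3 0)
    ((l₁ + l₂ + l₃) / l₃ * ((l₁ - l₂) - (l₁ + 2 * l₃ + l₄) * (1 + x₁) / (2 * x₁)))
    ((l₁ + l₂ + l₃) / l₃ * (l₁ + 2 * l₃ + l₄) / (2 * x₁)) 0 x₁ x₂ hR (fun t => by
      simp [Xi1]
      try field_simp
      try ring)
  have d11 := deriv_snd (f := fun t => Xi1 l₁ l₂ l₃ l₄ x₁ t 3 1)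
    (-((l₂ - l₄) * (l₂ + 2 * l₃ + l₄)) / l₃ + (l₁ * l₂ + l₁ * l₄ + l₂ * l₄ + 2 * l₃ * l₄ + l₄ ^ 2) / (2 * l₃) * (1 - x₁) / x₁)
    (-(l₁ * l₂ + l₁ * l₄ + l₂ * l₄ + 2 * l₃ * l₄ + l₄ ^ 2) / (2 * l₃ * x₁)) 0 x₁ x₂ hR (fun t => by
      simp [Xi1]
      try field_simp
      try ring)
  have d12 := deriv_snd (f := fun t => Xi1 l₁ l₂ l₃ l₄ x₁ t 3 2)
    ((l₁ * l₂ + l₁ * l₄ + l₂ * l₄ + 2 * l₃ * l₄ + l₄ ^ 2) / l₃ - (l₁ - l₄) * (l₁ + 2 * l₃ + l₄) / (2 * l₃) * (1 - x₁) / x₁)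
    ((l₁ - l₄) * (l₁ + 2 * l₃ + l₄) / (2 * l₃ * x₁)) 0 x₁ x₂ hR (fun t => by
      simp [Xi1]
      try field_simp
      try ring)
  have d13 := deriv_snd (f := fun t => Xi1 l₁ l₂ l₃ l₄ x₁ t 3 3)
    (-(l₁ - 2 * l₃ - 3 * l₄ + 2) * x₁ / 2 + (l₁ - l₄ + 1) - (l₁ + 2 * l₃ + l₄) / (2 * x₁))
    ((l₁ - l₄ + 1) + (l₁ + 2 * l₃ + l₄) / x₁) (-(l₁ + 2 * l₃ + l₄) / (2 * x₁)) x₁ x₂ hR (fun t => by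
      simp [Xi1]
      try field_simp
      try ring)
  have e1 := deriv_quad (f := fun t => Xi1 l₁ l₂ l₃ l₄ x₁ t 2 3)
    (-l₃ * (1 - x₁) / (2 * x₁)) (l₃ / (2 * x₁)) 0 x₂ (fun t => by
      simp [Xi1]
      try field_simp
      try ring)
  have d20 := deriv_fst (f := fun t => Xi2 l₁ l₂ l₃ l₄ t x₂ 3 0)
    ((l₁ + l₂ + l₃) / l₃ * ((l₂ - l₁) - (l₂ + 2 * l₃ + l₄) * (1 + x₂) / (2 * x₂)))
    ((l₁ + l₂ + l₃) / l₃ * (l₂ + 2 * l₃ + l₄) / (2 * x₂)) 0 x₁ x₂ hR (fun t => by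
      simp [Xi2]
      try field_simp
      try ring)
  have d21 := deriv_fst (f := fun t => Xi2 l₁ l₂ l₃ l₄ t x₂ 3 1)
    ((l₁ * l₂ + l₁ * l₄ + l₂ * l₄ + 2 * l₃ * l₄ + l₄ ^ 2) / l₃ - (l₂ - l₄) * (l₂ + 2 * l₃ + l₄) / (2 * l₃) * (1 - x₂) / x₂)
    ((l₂ - l₄) * (l₂ + 2 * l₃ + l₄) / (2 * l₃ * x₂)) 0 x₁ x₂ hR (fun t => by
      simp [Xi2]
      try field_simp
      try ring)
  have d22 := deriv_fst (f := fun t => Xi2 l₁ l₂ l₃ l₄ t x₂ 3 2)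
    (-((l₁ - l₄) * (l₁ + 2 * l₃ + l₄)) / l₃ + (l₁ * l₂ + l₁ * l₄ + l₂ * l₄ + 2 * l₃ * l₄ + l₄ ^ 2) / (2 * l₃) * (1 - x₂) / x₂)
    (-(l₁ * l₂ + l₁ * l₄ + l₂ * l₄ + 2 * l₃ * l₄ + l₄ ^ 2) / (2 * l₃ * x₂)) 0 x₁ x₂ hR (fun t => by
      simp [Xi2]
      try field_simp
      try ring)
  have d23 := deriv_fst (f := fun t => Xi2 l₁ l₂ l₃ l₄ t x₂ 3 3)
    (-(l₂ - 2 * l₃ - 3 * l₄ + 2) * x₂ / 2 + (l₂ - l₄ + 1) - (l₂ + 2 * l₃ + l₄) / (2 * x₂))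
    ((l₂ - l₄ + 1) + (l₂ + 2 * l₃ + l₄) / x₂) (-(l₂ + 2 * l₃ + l₄) / (2 * x₂)) x₁ x₂ hR (fun t => by
      simp [Xi2]
      try field_simp
      try ring)
  have e2 := deriv_quad (f := fun t => Xi2 l₁ l₂ l₃ l₄ t x₂ 1 3)
    (-l₃ * (1 - x₂) / (2 * x₂)) (l₃ / (2 * x₂)) 0 x₁ (fun t => by
      simp [Xi2]
      try field_simp
      try ring)
  have hRd : Rpoly x₁ x₂ = x₁ ^ 2 + x₂ ^ 2 - 2 * x₁ * x₂ - 2 * x₁ - 2 * x₂ + 1 := rfl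
  intro i j
  rw [Matrix.sub_apply, Matrix.mul_apply, Matrix.mul_apply, Fin.sum_univ_four, Fin.sum_univ_four]
  fin_cases i <;> fin_cases j <;>
    simp only [Fin.zero_eta, Fin.mk_one, Fin.reduceFinMk, d10, d11, d12, d13, d20, d21, d22, d23,
      e1, e2] <;>
    simp [Xi1, Xi2] <;>
    generalize Rpoly x₁ x₂ = R at hR hRd ⊢ <;>
    (try field_simp) <;> (try rw [hRd]) <;> (try ring)
end

section
/- Let Ĉ be the 4×4 symmetric matrix with Ĉᵢⱼ = Cᵢⱼ for 1 ≤ i,j ≤ 3 (from Proposition 3.2, with R(x) removed), Ĉ₄₄ = 2/(λ₃λ₄), and Ĉᵢ₄ = Ĉ₄ᵢ = 0 for i ≤ 3. Let Ξ̂ᵛ denote the matrix obtained from a matrix Ξ̂ by replacing every λᵢ with −λᵢ. Then each of Ξ̂¹, Ξ̂², Ξ̂³ satisfies Ξ̂ᵏ Ĉ + Ĉ ᵗ(Ξ̂ᵏ)ᵛ = 0 and (Ξ̂ᵏ)ᵛ = −Ξ̂ᵏ. -/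
open Matrix

/-- The constant matrix `Ξ̂¹` of Theorem 5.3. -/
noncomputable def XiHat1 (l₁ l₂ l₃ l₄ : ℂ) : Matrix (Fin 4) (Fin 4) ℂ :=
  let l₁₂₃ := l₁ + l₂ + l₃
  let l₁₃₄ := -(l₁ + l₃ + l₄)
  !![0, -l₄, 0, 0;
     0, -l₁ - l₃, 0, 0;
     -l₁₂₃ / 2, (-l₂ + l₄) / 2, (-l₁ + l₄) / 2, -l₃ / 2;
     (l₁₃₄ - l₃) * l₁₂₃ / (2 * l₃), l₄ + (l₂ + l₄) * (l₁ + l₄) / (2 * l₃),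
       (l₁ - l₄) * (l₁₃₄ - l₃) / (2 * l₃), (l₁₃₄ - l₃) / 2]

/-- The constant matrix `Ξ̂²` of Theorem 5.3. -/
noncomputable def XiHat2 (l₁ l₂ l₃ l₄ : ℂ) : Matrix (Fin 4) (Fin 4) ℂ :=
  let l₁₂₃ := l₁ + l₂ + l₃
  let l₂₃₄ := -(l₂ + l₃ + l₄)
  !![0, 0, -l₄, 0;
     -l₁₂₃ / 2, (-l₂ + l₄) / 2, (-l₁ + l₄) / 2, -l₃ / 2;
     0, 0, -l₃ - l₂, 0;
     (l₂₃₄ - l₃) * l₁₂₃ / (2 * l₃), (l₂ - l₄) * (l₂₃₄ - l₃) / (2 * l₃),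
       l₄ + (l₂ + l₄) * (l₁ + l₄) / (2 * l₃), (l₂₃₄ - l₃) / 2]

/-- The constant matrix `Ξ̂³` of Theorem 5.3. -/
noncomputable def XiHat3 (l₁ l₂ l₃ l₄ : ℂ) : Matrix (Fin 4) (Fin 4) ℂ :=
  !![0, 0, 0, 0;
     0, 0, 0, 0;
     0, 0, 0, 0;
     0, 0, 0, 2 * (l₃ + l₄)]

/-- `I₃,₁ = diag(1,1,1,-1)`. -/
noncomputable def I31 : Matrix (Fin 4) (Fin 4) ℂ :=
  !![1, 0, 0, 0; 0, 1, 0, 0; 0, 0, 1, 0; 0, 0, 0, -1]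

/-- The intersection matrix `Ĉ` of Corollary 5.5. -/
noncomputable def CHat (l₁ l₂ l₃ l₄ : ℂ) : Matrix (Fin 4) (Fin 4) ℂ :=
  let l₀ := -(l₁ + l₂ + 2 * l₃ + l₄)
  let l₁₂₃ := l₁ + l₂ + l₃
  let l₁₃₄ := -(l₁ + l₃ + l₄)
  let l₂₃₄ := -(l₂ + l₃ + l₄)
  !![(1/l₁₂₃) * (1/l₁ + 1/l₂) + (1/l₁₃₄) * (1/l₀ + 1/l₂) + (1/l₂₃₄) * (1/l₀ + 1/l₁),
       -(1/l₁₃₄) * (1/l₀ + 1/l₂), -(1/l₂₃₄) * (1/l₀ + 1/l₁), 0;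
     -(1/l₁₃₄) * (1/l₀ + 1/l₂), (1/l₀ + 1/l₂) * (1/l₄ + 1/l₁₃₄), -(1/(l₀ * l₄)), 0;
     -(1/l₂₃₄) * (1/l₀ + 1/l₁), -(1/(l₀ * l₄)), (1/l₀ + 1/l₁) * (1/l₄ + 1/l₂₃₄), 0;
     0, 0, 0, 2/(l₃ * l₄)]

set_option maxHeartbeats 4000000 in
/-- Lemma 5.6: with `(·)ᵛ` denoting `λᵢ ↦ -λᵢ`, each `Ξ̂ᵏ` satisfies
`(Ξ̂ᵏ)ᵛ = -Ξ̂ᵏ` and `Ξ̂ᵏ Ĉ + Ĉ ᵗ(Ξ̂ᵏ)ᵛ = 0`. -/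
theorem XiHat_CHat_compat (l₁ l₂ l₃ l₄ : ℂ)
    (h1 : l₁ ≠ 0) (h2 : l₂ ≠ 0) (h3 : l₃ ≠ 0) (h4 : l₄ ≠ 0)
    (h0 : -(l₁ + l₂ + 2 * l₃ + l₄) ≠ 0) (h123 : l₁ + l₂ + l₃ ≠ 0)
    (h134 : -(l₁ + l₃ + l₄) ≠ 0) (h234 : -(l₂ + l₃ + l₄) ≠ 0) :
    (XiHat1 (-l₁) (-l₂) (-l₃) (-l₄) = -XiHat1 l₁ l₂ l₃ l₄ ∧
      XiHat2 (-l₁) (-l₂) (-l₃) (-l₄) = -XiHat2 l₁ l₂ l₃ l₄ ∧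
      XiHat3 (-l₁) (-l₂) (-l₃) (-l₄) = -XiHat3 l₁ l₂ l₃ l₄) ∧
    (XiHat1 l₁ l₂ l₃ l₄ * CHat l₁ l₂ l₃ l₄
        + CHat l₁ l₂ l₃ l₄ * (XiHat1 (-l₁) (-l₂) (-l₃) (-l₄))ᵀ = 0 ∧
      XiHat2 l₁ l₂ l₃ l₄ * CHat l₁ l₂ l₃ l₄
        + CHat l₁ l₂ l₃ l₄ * (XiHat2 (-l₁) (-l₂) (-l₃) (-l₄))ᵀ = 0 ∧
      XiHat3 l₁ l₂ l₃ l₄ * CHat l₁ l₂ l₃ l₄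
        + CHat l₁ l₂ l₃ l₄ * (XiHat3 (-l₁) (-l₂) (-l₃) (-l₄))ᵀ = 0) := by
  have h0' : l₁ + l₂ + 2 * l₃ + l₄ ≠ 0 := neg_ne_zero.mp h0
  have h134' : l₁ + l₃ + l₄ ≠ 0 := neg_ne_zero.mp h134
  have h234' : l₂ + l₃ + l₄ ≠ 0 := neg_ne_zero.mp h234
  have e1 : XiHat1 (-l₁) (-l₂) (-l₃) (-l₄) = -XiHat1 l₁ l₂ l₃ l₄ := by
    ext i j
    fin_cases i <;> fin_cases j <;> simp [XiHat1] <;> (try field_simp) <;> ring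
  have e2 : XiHat2 (-l₁) (-l₂) (-l₃) (-l₄) = -XiHat2 l₁ l₂ l₃ l₄ := by
    ext i j
    fin_cases i <;> fin_cases j <;> simp [XiHat2] <;> (try field_simp) <;> ring
  have e3 : XiHat3 (-l₁) (-l₂) (-l₃) (-l₄) = -XiHat3 l₁ l₂ l₃ l₄ := by
    ext i j
    fin_cases i <;> fin_cases j <;> simp [XiHat3] <;> ring
  obtain ⟨m, hm⟩ : ∃ m, m = l₁ + l₂ + 2 * l₃ + l₄ := ⟨_, rfl⟩
  have hm0 : m ≠ 0 := hm ▸ h0'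
  refine ⟨⟨e1, e2, e3⟩, ?_, ?_, ?_⟩
  · rw [e1]
    ext i j
    fin_cases i <;> fin_cases j <;>
      simp only [XiHat1, CHat, Matrix.add_apply, Matrix.mul_apply, Fin.sum_univ_four,
        Matrix.transpose_apply, Matrix.neg_apply, Matrix.zero_apply] <;>
      simp [-one_div, -neg_add_rev, div_neg] <;>
      (try simp only [← hm]) <;> (try field_simp) <;> subst hm <;> ring
  · rw [e2]
    ext i j
    fin_cases i <;> fin_cases j <;>
      simp only [XiHat2, CHat, Matrix.add_apply, Matrix.mul_apply, Fin.sum_univ_four,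
        Matrix.transpose_apply, Matrix.neg_apply, Matrix.zero_apply] <;>
      simp [-one_div, -neg_add_rev, div_neg] <;>
      (try simp only [← hm]) <;> (try field_simp) <;> subst hm <;> ring
  · rw [e3]
    ext i j
    fin_cases i <;> fin_cases j <;>
      simp only [XiHat3, CHat, Matrix.add_apply, Matrix.mul_apply, Fin.sum_univ_four,
        Matrix.transpose_apply, Matrix.neg_apply, Matrix.zero_apply] <;>
      simp [-one_div, -neg_add_rev, div_neg] <;> ring
end

section
/- With e₂ = (0,1,0,0), e₅ = (λ₁₂₃/λ₃, (λ₂−λ₄)/λ₃, (λ₁−λ₄)/λ₃, 1), and Ĉ₁ the 2×2 matrix with entries (e₂Ĉ ᵗe₂, e₂Ĉ ᵗe₅; e₅Ĉ ᵗe₂, e₅Ĉ ᵗe₅), the matrix Ξ̂¹ admits the rank-2 factorization Ξ̂¹ = −(λ₁+λ₃) Ĉ (ᵗe₂, ᵗe₅) Ĉ₁⁻¹ (e₂; e₅), where (ᵗe₂, ᵗe₅) is the 4×2 matrix with columns ᵗe₂, ᵗe₅ and (e₂; e₅) the 2×4 matrix with rows e₂, e₅. -/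
open Matrix

/-- Lemma 5.9 (first case): the rank-2 factorization
`Ξ̂¹ = -(λ₁+λ₃) Ĉ (ᵗe₂, ᵗe₅) Ĉ₁⁻¹ (e₂; e₅)`. -/
theorem XiHat1_factorization (l₁ l₂ l₃ l₄ : ℂ)
    (h1 : l₁ ≠ 0) (h2 : l₂ ≠ 0) (h3 : l₃ ≠ 0) (h4 : l₄ ≠ 0)
    (h0 : -(l₁ + l₂ + 2 * l₃ + l₄) ≠ 0) (h123 : l₁ + l₂ + l₃ ≠ 0)
    (h134 : -(l₁ + l₃ + l₄) ≠ 0) (h234 : -(l₂ + l₃ + l₄) ≠ 0)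
    (h13 : l₁ + l₃ ≠ 0) (h23 : l₂ + l₃ ≠ 0) :
    let l₀ := -(l₁ + l₂ + 2 * l₃ + l₄);
    let l₁₃₄ := -(l₁ + l₃ + l₄);
    let e₂ : Fin 4 → ℂ := ![0, 1, 0, 0];
    let e₅ : Fin 4 → ℂ :=
      ![(l₁ + l₂ + l₃) / l₃, (l₂ - l₄) / l₃, (l₁ - l₄) / l₃, 1];
    let E : Matrix (Fin 4) (Fin 2) ℂ := Matrix.of fun i j => ![e₂, e₅] j i;
    let F : Matrix (Fin 2) (Fin 4) ℂ := Matrix.of fun i j => ![e₂, e₅] i j;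
    let C1 : Matrix (Fin 2) (Fin 2) ℂ :=
      !![(l₃ - l₁₃₄) * (l₁ + l₃) / (l₀ * l₂ * l₄ * l₁₃₄),
           -2 * (l₁ + l₃) / (l₀ * l₃ * l₄);
         -2 * (l₁ + l₃) / (l₀ * l₃ * l₄),
           -4 * (l₂ + l₃) * (l₁ + l₃) / (l₀ * l₃ ^ 2 * l₄)];
    XiHat1 l₁ l₂ l₃ l₄ = (-(l₁ + l₃)) • (CHat l₁ l₂ l₃ l₄ * E * C1⁻¹ * F) := by
  intro l₀ l₁₃₄ e₂ e₅ E F C1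
  have h0' : l₁ + l₂ + 2 * l₃ + l₄ ≠ 0 := fun h => h0 (by rw [h, neg_zero])
  have h134' : l₁ + l₃ + l₄ ≠ 0 := fun h => h134 (by rw [h, neg_zero])
  have h234' : l₂ + l₃ + l₄ ≠ 0 := fun h => h234 (by rw [h, neg_zero])
  obtain ⟨s, hs⟩ : ∃ s, s = l₁ + l₂ + 2 * l₃ + l₄ := ⟨_, rfl⟩
  have hs0 : s ≠ 0 := hs ▸ h0'
  have hdet : C1.det ≠ 0 := by
    have : C1.det = -4 * (l₁ + l₃) ^ 2 /
        ((l₁ + l₂ + 2 * l₃ + l₄) * l₃ * l₄ ^ 2 * l₂ * -(l₁ + l₃ + l₄)) := by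
      simp only [C1, l₀, l₁₃₄, Matrix.det_fin_two_of, ← hs]
      field_simp
      rw [hs]
      ring
    rw [this]
    have : (-4 : ℂ) ≠ 0 := by norm_num
    positivity
  let L : Matrix (Fin 4) (Fin 2) ℂ :=
    !![-l₄, 0; -(l₁ + l₃), 0; 0, -l₃ / 2;
      l₂ * (l₁ + l₃ + l₄) / l₃, -(l₁ + 2 * l₃ + l₄) / 2]
  have hX : XiHat1 l₁ l₂ l₃ l₄ = L * F := by
    ext i j
    fin_cases i <;> fin_cases j <;>
      simp [XiHat1, L, F, e₂, e₅, Matrix.mul_apply, Fin.sum_univ_two] <;>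
      (try field_simp) <;> (try ring)
  have hC : (-(l₁ + l₃)) • (CHat l₁ l₂ l₃ l₄ * E) = L * C1 := by
    ext i j
    rw [Matrix.smul_apply, Matrix.mul_apply, Matrix.mul_apply, Fin.sum_univ_two,
      Fin.sum_univ_four, smul_eq_mul]
    fin_cases i <;> fin_cases j <;>
      simp [CHat, L, E, C1, e₂, e₅, l₀, l₁₃₄, -neg_add_rev, -mul_eq_mul_left_iff] <;>
      (try simp only [← hs]) <;> (try field_simp) <;> (try simp only [hs]) <;> (try ring)
  rw [← Matrix.smul_mul, ← Matrix.smul_mul, hC, Matrix.mul_assoc L,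
    Matrix.mul_nonsing_inv _ (isUnit_iff_ne_zero.mpr hdet), Matrix.mul_one, hX]
end
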